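/- (Pointwise decay for non-convolution Calderón–Zygmund operators.) Let $L\ge -1$ be an integer and let $T$ be a Calderón–Zygmund operator associated with a kernel $K$ satisfying $|\partial_y^\beta K(x,y+h)-\partial_y^\beta K(x,y)|\le C|h|^\delta|x-y|^{-(n+L+1+\delta)}$ for all $x\ne y$, $|h|\le|x-y|/2$, and all multi-indices $|\beta|=L+1$, and suppose $\int x^\beta\,Ta(x)\,dx=0$ for all $(L+1,\infty)$ atoms $a$ and all $|\beta|\le L$ (this condition is disregarded if $L=-1$). Let $\phi\in C_c^\infty$ with $\operatorname{supp}\phi\subset B(0,1)$ and $\int\phi\,dx=1$, and set $M_\phi g(x)=\sup_{t>0}|\phi_t*g(x)|$. Then there is a constant $C'$ such that for every $(L+1,\infty)$ atom $a$ with $\operatorname{supp}(a)\subset Q$ and all $x\in(Q^{**})^c$, $$M_\phi(Ta)(x)\le C'\,M(\chi_Q)(x)^{(n+L+1)/n}.$$ -/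

import Mathlib

open MeasureTheory ENNReal Filter Topology

noncomputable section

/-- Euclidean space `ℝⁿ`. -/
abbrev Rn (n : ℕ) := EuclideanSpace ℝ (Fin n)

variable {n : ℕ}

/-- The closed axis-parallel cube with center `c` and half side length `r`. -/
def stdCube (c : Rn n) (r : ℝ) : Set (Rn n) := {y | ∀ i, |y i - c i| ≤ r}

/-- A cube with sides parallel to the coordinate axes. -/
def IsCube (Q : Set (Rn n)) : Prop := ∃ (c : Rn n) (r : ℝ), 0 < r ∧ Q = stdCube c r

/-- The average `⨍_Q f` of `f` over `Q`. -/
def cubeAvg (Q : Set (Rn n)) (f : Rn n → ℝ) : ℝ := (volume Q).toReal⁻¹ * ∫ y in Q, f y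

/-- The average `⨍_Q f` of a nonnegative function over `Q`, computed in `ℝ≥0∞`. -/
def cubeAvgE (Q : Set (Rn n)) (f : Rn n → ℝ) : ℝ≥0∞ :=
  (∫⁻ y in Q, ENNReal.ofReal (f y)) / volume Q

/-- The `L^q` average `(⨍_Q f^q)^{1/q}` of a nonnegative function over `Q`, in `ℝ≥0∞`. -/
def cubeAvgEq (Q : Set (Rn n)) (f : Rn n → ℝ) (q : ℝ) : ℝ≥0∞ :=
  ((∫⁻ y in Q, ENNReal.ofReal (f y) ^ q) / volume Q) ^ (1/q)

/-- A weight: a nonnegative locally integrable function, positive a.e. -/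
def IsWeight (w : Rn n → ℝ) : Prop :=
  LocallyIntegrable w volume ∧ (∀ x, 0 ≤ w x) ∧ ∀ᵐ x ∂(volume : Measure (Rn n)), 0 < w x

/-- The Muckenhoupt `A_1` condition with constant `C`. -/
def MuckA1With (w : Rn n → ℝ) (C : ℝ) : Prop :=
  ∀ Q : Set (Rn n), IsCube Q → ∀ᵐ x ∂(volume : Measure (Rn n)), x ∈ Q → cubeAvg Q w ≤ C * w x

/-- The Muckenhoupt `A_r` condition (`1 < r`) with constant `C`. -/
def MuckArWith (w : Rn n → ℝ) (r C : ℝ) : Prop :=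
  ∀ Q : Set (Rn n), IsCube Q →
    cubeAvg Q w * (cubeAvg Q fun x => w x ^ (1 - r / (r - 1))) ^ (r - 1) ≤ C

/-- The Muckenhoupt `A_r` condition, `r ≥ 1`. -/
def MuckA (w : Rn n → ℝ) (r : ℝ) : Prop :=
  (r = 1 ∧ ∃ C : ℝ, 0 < C ∧ MuckA1With w C) ∨
  (1 < r ∧ ∃ C : ℝ, 0 < C ∧ MuckArWith w r C)

/-- The class `A_∞ = ⋃_{r ≥ 1} A_r`. -/
def AInfty (w : Rn n → ℝ) : Prop := ∃ r : ℝ, 1 ≤ r ∧ MuckA w r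

/-- `r_w = inf { r ≥ 1 : w ∈ A_r }`. -/
def rIdx (w : Rn n → ℝ) : ℝ := sInf {r : ℝ | 1 ≤ r ∧ MuckA w r}

/-- The reverse Hölder condition `RH_s` with constant `C`. -/
def RHWith (w : Rn n → ℝ) (s C : ℝ) : Prop :=
  ∀ Q : Set (Rn n), IsCube Q → (cubeAvg Q fun x => w x ^ s) ^ (1/s) ≤ C * cubeAvg Q w

/-- The reverse Hölder class `RH_s`, `1 < s < ∞`. -/
def RH (w : Rn n → ℝ) (s : ℝ) : Prop := ∃ C : ℝ, 0 < C ∧ RHWith w s C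

/-- The reverse Hölder class `RH_∞`. -/
def RHInfty (w : Rn n → ℝ) : Prop :=
  ∃ C : ℝ, 0 < C ∧ ∀ Q : Set (Rn n), IsCube Q →
    ∀ᵐ x ∂(volume : Measure (Rn n)), x ∈ Q → w x ≤ C * cubeAvg Q w

/-- The weighted Lebesgue quasi-norm `‖f‖_{L^p(w)}`. -/
def weightedLp (p : ℝ) (w : Rn n → ℝ) (f : Rn n → ℝ) : ℝ≥0∞ :=
  (∫⁻ x, ENNReal.ofReal |f x| ^ p * ENNReal.ofReal (w x)) ^ (1/p)

/-- The weighted Lebesgue quasi-norm, for `ℝ≥0∞`-valued functions. -/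
def weightedLpE (p : ℝ) (w : Rn n → ℝ) (F : Rn n → ℝ≥0∞) : ℝ≥0∞ :=
  (∫⁻ x, F x ^ p * ENNReal.ofReal (w x)) ^ (1/p)

/-- The variable Lebesgue quasi-norm `‖F‖_{L^{p(·)}}`, for `ℝ≥0∞`-valued functions. -/
def varLpE (p : Rn n → ℝ) (F : Rn n → ℝ≥0∞) : ℝ≥0∞ :=
  sInf {lam : ℝ≥0∞ | 0 < lam ∧ ∫⁻ x, (F x / lam) ^ (p x) ≤ 1}

/-- The variable Lebesgue quasi-norm `‖f‖_{L^{p(·)}}`. -/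
def varLp (p : Rn n → ℝ) (f : Rn n → ℝ) : ℝ≥0∞ :=
  varLpE p fun x => ENNReal.ofReal |f x|

/-- An exponent function in `𝒫₀`: measurable with values in `(0,∞)`. -/
def ExponentP0 (p : Rn n → ℝ) : Prop := Measurable p ∧ ∀ x, 0 < p x

/-- Log-Hölder continuity, locally and at infinity. -/
def LogHolder (p : Rn n → ℝ) : Prop :=
  (∃ C₀ : ℝ, 0 < C₀ ∧ ∀ x y : Rn n, 0 < ‖x - y‖ → ‖x - y‖ < 1/2 →
      |p x - p y| ≤ C₀ / (-Real.log ‖x - y‖)) ∧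
  (∃ pinf Cinf : ℝ, 0 < Cinf ∧ ∀ x : Rn n, |p x - pinf| ≤ Cinf / Real.log (Real.exp 1 + ‖x‖))

/-- The partial derivative `∂_i f`. -/
def pderiv (i : Fin n) (f : Rn n → ℝ) : Rn n → ℝ :=
  fun x => fderiv ℝ f x (EuclideanSpace.single i 1)

/-- The higher-order partial derivative `∂^β f` for a multi-index `β`. -/
def multiDeriv (β : Fin n → ℕ) (f : Rn n → ℝ) : Rn n → ℝ :=
  (List.finRange n).foldr (fun i g => (pderiv i)^[β i] g) f

/-- An `(N,∞)` atom supported in the cube `Q`. -/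
def IsNAtom (N : ℕ) (a : Rn n → ℝ) (Q : Set (Rn n)) : Prop :=
  Measurable a ∧ (∀ x, |a x| ≤ 1) ∧ IsCube Q ∧ Function.support a ⊆ Q ∧
    ∀ β : Fin n → ℕ, (∑ i, β i) ≤ N → ∫ x, (∏ i, x i ^ β i) * a x = 0

/-- Membership in `𝒪_N`: a smooth compactly supported function with vanishing moments
up to order `N`. -/
def InON (N : ℕ) (f : Rn n → ℝ) : Prop :=
  ContDiff ℝ (⊤ : ℕ∞) f ∧ HasCompactSupport f ∧
    ∀ β : Fin n → ℕ, (∑ i, β i) ≤ N → ∫ x, (∏ i, x i ^ β i) * f x = 0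

/-- Tempered distributions on `ℝⁿ`. -/
abbrev TemperedDist (n : ℕ) := SchwartzMap (Rn n) ℝ →L[ℝ] ℝ

/-- The tempered distribution `u` is represented by the function `f`. -/
def Represents (u : TemperedDist n) (f : Rn n → ℝ) : Prop :=
  ∀ ψ : SchwartzMap (Rn n) ℝ, u ψ = ∫ x, f x * ψ x

/-- Membership in the class `𝒮_{N₀}`:
`∫ (1+|x|)^{N₀} (∑_{|β| ≤ N₀} |∂^β φ(x)|²) dx ≤ 1`. -/
def inSN (N₀ : ℕ) (φ : SchwartzMap (Rn n) ℝ) : Prop :=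
  ∫ x : Rn n, (1 + ‖x‖) ^ N₀ *
      ∑ β : Fin n → Fin (N₀ + 1),
        (if (∑ i, (β i : ℕ)) ≤ N₀ then
          (multiDeriv (fun i => (β i : ℕ)) (fun y => φ y) x) ^ 2 else 0) ≤ 1

/-- The grand maximal function `𝓜_{N₀} u (x) = sup_{φ ∈ 𝒮_{N₀}} sup_{t>0} |φ_t * u (x)|`,
where `φ_t * u (x) = u (y ↦ t^{-n} φ((x-y)/t))`. -/
def grandMax (N₀ : ℕ) (u : TemperedDist n) (x : Rn n) : ℝ≥0∞ :=
  sSup {r : ℝ≥0∞ | ∃ (φ ψ : SchwartzMap (Rn n) ℝ) (t : ℝ), 0 < t ∧ inSN N₀ φ ∧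
      (∀ y, ψ y = ((t ^ n)⁻¹ : ℝ) * φ (t⁻¹ • (x - y))) ∧ r = ENNReal.ofReal |u ψ|}

/-- The weighted Hardy space quasi-norm `‖u‖_{H^p(w)} = ‖𝓜_{N₀} u‖_{L^p(w)}`. -/
def hardyNorm (N₀ : ℕ) (p : ℝ) (w : Rn n → ℝ) (u : TemperedDist n) : ℝ≥0∞ :=
  weightedLpE p w (grandMax N₀ u)

/-- The variable Hardy space quasi-norm `‖u‖_{H^{p(·)}} = ‖𝓜_{N₀} u‖_{L^{p(·)}}`. -/
def hardyNormVar (N₀ : ℕ) (p : Rn n → ℝ) (u : TemperedDist n) : ℝ≥0∞ :=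
  varLpE p (grandMax N₀ u)

/-- The fractional maximal operator `M_γ` (the Hardy–Littlewood maximal operator if
`γ = 0`). -/
def fracMax (γ : ℝ) (f : Rn n → ℝ) (x : Rn n) : ℝ≥0∞ :=
  ⨆ (Q : Set (Rn n)) (_ : IsCube Q ∧ x ∈ Q),
    volume Q ^ (γ / (n : ℝ)) * ((∫⁻ y in Q, ENNReal.ofReal |f y|) / volume Q)

/-- `T` is bounded on (unweighted) `L²`. -/
def L2Bounded (T : (Rn n → ℝ) → Rn n → ℝ) : Prop :=
  ∃ A : ℝ, 0 < A ∧ ∀ f : Rn n → ℝ, Measurable f →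
    weightedLp 2 (fun _ => 1) (T f) ≤ ENNReal.ofReal A * weightedLp 2 (fun _ => 1) f

/-- The standard kernel size estimate `|K(x,y)| ≤ C|x-y|^{-n}`. -/
def CZKernelSize (K : Rn n → Rn n → ℝ) (C : ℝ) : Prop :=
  ∀ x y : Rn n, x ≠ y → |K x y| ≤ C * ‖x - y‖ ^ (-(n : ℝ))

/-- The standard kernel smoothness (Hölder) estimate of order `δ`. -/
def CZKernelSmooth (K : Rn n → Rn n → ℝ) (δ C : ℝ) : Prop :=
  ∀ x y h : Rn n, x ≠ y → ‖h‖ ≤ ‖x - y‖ / 2 →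
    |K x (y + h) - K x y| + |K (x + h) y - K x y| ≤ C * ‖h‖ ^ δ * ‖x - y‖ ^ (-(n : ℝ) - δ)

/-- A (non-convolution type) Calderón–Zygmund operator: bounded on `L²`, represented off
the support by a kernel `K` satisfying the standard estimates with exponent `δ`. -/
def CZOp (T : (Rn n → ℝ) → Rn n → ℝ) (K : Rn n → Rn n → ℝ) (δ : ℝ) : Prop :=
  L2Bounded T ∧ 0 < δ ∧ δ ≤ 1 ∧
  (∃ C : ℝ, 0 < C ∧ CZKernelSize K C ∧ CZKernelSmooth K δ C) ∧
  ∀ f : Rn n → ℝ, Measurable f → (∃ M : ℝ, ∀ x, |f x| ≤ M) → HasCompactSupport f →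
    ∀ x ∉ tsupport f, T f x = ∫ y, K x y * f y

/-- The higher-order smoothness condition on the kernel:
`|∂_y^β K(x,y+h) - ∂_y^β K(x,y)| ≤ C |h|^δ |x-y|^{-(n+m+δ)}` for all `|β| = m`. -/
def KernelHigherSmooth (K : Rn n → Rn n → ℝ) (δ : ℝ) (m : ℕ) (C : ℝ) : Prop :=
  (∀ x : Rn n, ContDiffOn ℝ m (fun z => K x z) {x}ᶜ) ∧
  ∀ β : Fin n → ℕ, (∑ i, β i) = m →
    ∀ x y h : Rn n, x ≠ y → ‖h‖ ≤ ‖x - y‖ / 2 →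
      |multiDeriv β (fun z => K x z) (y + h) - multiDeriv β (fun z => K x z) y|
        ≤ C * ‖h‖ ^ δ * ‖x - y‖ ^ (-((n : ℝ) + m + δ))

/-- `T` has `L` vanishing moments: `∫ x^β T a(x) dx = 0` for all `(L+1,∞)` atoms `a` and
all multi-indices `|β| ≤ L`.  (Vacuous if `L = -1`.) -/
def VanishingMoments (T : (Rn n → ℝ) → Rn n → ℝ) (L : ℤ) : Prop :=
  ∀ (a : Rn n → ℝ) (Q : Set (Rn n)), IsNAtom (L + 1).toNat a Q →
    ∀ β : Fin n → ℕ, (∑ i, (β i : ℤ)) ≤ L → ∫ x, (∏ i, x i ^ β i) * T a x = 0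

/-- Regularity of order `N+1` for a convolution kernel:
`|∂^α K(x)| ≤ A |x|^{-n-|α|}` for all `|α| ≤ N+1`. -/
def ConvKernelReg (K : Rn n → ℝ) (N : ℕ) : Prop :=
  ContDiffOn ℝ (N + 1 : ℕ) K {0}ᶜ ∧
  ∃ A : ℝ, 0 < A ∧ ∀ β : Fin n → ℕ, (∑ i, β i) ≤ N + 1 →
    ∀ x : Rn n, x ≠ 0 → |multiDeriv β K x| ≤ A * ‖x‖ ^ (-(n : ℝ) - (∑ i, β i))

/-- A Calderón–Zygmund singular integral operator of convolution type with regularity of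
order `N+1`: `T` is bounded on `L²` (equivalently, the kernel has bounded Fourier
transform), and `T f(x) = p.v. ∫ K(x-y) f(y) dy` for `f ∈ C_c^∞`. -/
def ConvCZO (T : (Rn n → ℝ) → Rn n → ℝ) (K : Rn n → ℝ) (N : ℕ) : Prop :=
  L2Bounded T ∧ ConvKernelReg K N ∧
  ∀ f : Rn n → ℝ, ContDiff ℝ (⊤ : ℕ∞) f → HasCompactSupport f → ∀ x : Rn n,
    Tendsto (fun ε : ℝ => ∫ y in {y : Rn n | ε < ‖x - y‖}, K (x - y) * f y)
      (𝓝[>] 0) (𝓝 (T f x))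

/-- The fractional integral operator `I_α`. -/
def fracInt (α : ℝ) (f : Rn n → ℝ) (x : Rn n) : ℝ :=
  ∫ y, f y * ‖x - y‖ ^ (α - (n : ℝ))

/-- The radial maximal function `M_φ g(x) = sup_{t>0} |φ_t * g(x)|` of a function `g`. -/
def MphiSup (φ : Rn n → ℝ) (g : Rn n → ℝ) (x : Rn n) : ℝ≥0∞ :=
  ⨆ (t : ℝ) (_ : 0 < t), ENNReal.ofReal |∫ y, (t ^ n)⁻¹ * φ (t⁻¹ • (x - y)) * g y|

/-- The iterated partial derivative along a list of coordinate directions; the head of the list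
is the outermost derivative. -/
def listDeriv (l : List (Fin n)) (f : Rn n → ℝ) : Rn n → ℝ := l.foldr pderiv f

/-- The `k`-th order directional derivative of `f` at `z` along `v`, expanded into iterated
partial derivatives. -/
def dirDeriv : ℕ → Rn n → (Rn n → ℝ) → Rn n → ℝ
  | 0, _, f, z => f z
  | k + 1, v, f, z => ∑ i, v i * dirDeriv k v (pderiv i f) z

theorem listDeriv_append_singleton (l : List (Fin n)) (i : Fin n) (f : Rn n → ℝ) :
    listDeriv (l ++ [i]) f = listDeriv l (pderiv i f) := by
  simp [listDeriv]

theorem pderiv_eqOn {U : Set (Rn n)} (hU : IsOpen U) {f g : Rn n → ℝ} (h : Set.EqOn f g U)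
    (i : Fin n) : Set.EqOn (pderiv i f) (pderiv i g) U := by
  intro x hx
  have : f =ᶠ[𝓝 x] g := Filter.eventuallyEq_of_mem (hU.mem_nhds hx) h
  simp [pderiv, this.fderiv_eq]

theorem contDiffOn_pderiv {U : Set (Rn n)} (hU : IsOpen U) {f : Rn n → ℝ} {k : ℕ}
    (hf : ContDiffOn ℝ (k + 1 : ℕ) f U) (i : Fin n) : ContDiffOn ℝ k (pderiv i f) U := by
  have h : ContDiffOn ℝ k (fderiv ℝ f) U := hf.fderiv_of_isOpen hU (by norm_cast)
  exact h.clm_apply contDiffOn_const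

theorem contDiffOn_listDeriv {U : Set (Rn n)} (hU : IsOpen U) {f : Rn n → ℝ} :
    ∀ (l : List (Fin n)) (k : ℕ), ContDiffOn ℝ (k + l.length : ℕ) f U →
      ContDiffOn ℝ k (listDeriv l f) U
  | [], k, hf => by simpa [listDeriv] using hf
  | i :: l, k, hf => by
      refine contDiffOn_pderiv hU (f := listDeriv l f) ?_ i
      refine contDiffOn_listDeriv hU l (k + 1) ?_
      convert hf using 2
      simp; ring

theorem pderiv_comm_of_contDiffOn {U : Set (Rn n)} (hU : IsOpen U) {f : Rn n → ℝ}
    (hf : ContDiffOn ℝ 2 f U) (i j : Fin n) :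
    Set.EqOn (pderiv i (pderiv j f)) (pderiv j (pderiv i f)) U := by
  intro x hx
  have hfx : ContDiffAt ℝ 2 f x := hf.contDiffAt (hU.mem_nhds hx)
  have hs := hfx.isSymmSndFDerivAt (by simp)
  have hd : DifferentiableAt ℝ (fderiv ℝ f) x :=
    (hfx.fderiv_right (m := 1) (by norm_num)).differentiableAt (by norm_num)
  have key : ∀ a b : Fin n, pderiv a (pderiv b f) x =
      fderiv ℝ (fderiv ℝ f) x (EuclideanSpace.single a 1) (EuclideanSpace.single b 1) := by
    intro a b
    have : HasFDerivAt (pderiv b f)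
        ((fderiv ℝ (fderiv ℝ f) x).flip (EuclideanSpace.single b 1)) x := by
      refine (hd.hasFDerivAt.clm_apply
        (hasFDerivAt_const (EuclideanSpace.single b (1 : ℝ)) x)).congr_fderiv ?_
      ext v; simp
    rw [pderiv, this.fderiv]; rfl
  rw [key, key]
  exact hs _ _

theorem listDeriv_perm {U : Set (Rn n)} (hU : IsOpen U) {f : Rn n → ℝ} {l₁ l₂ : List (Fin n)}
    (h : l₁.Perm l₂) :
    ∀ m : ℕ, l₁.length ≤ m → ContDiffOn ℝ m f U → Set.EqOn (listDeriv l₁ f) (listDeriv l₂ f) U := by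
  induction h with
  | nil => intro m _ _; exact Set.eqOn_refl _ _
  | cons i _ ih =>
    intro m hm hf
    exact pderiv_eqOn hU (ih m (by simp at hm; omega) hf) i
  | swap i j l =>
    intro m hm hf
    refine pderiv_comm_of_contDiffOn hU (f := listDeriv l f) ?_ j i
    exact contDiffOn_listDeriv hU l 2 (hf.of_le (by norm_cast; simp at hm; omega))
  | trans h₁ _ ih₁ ih₂ =>
    intro m hm hf
    exact (ih₁ m hm hf).trans (ih₂ m (h₁.length_eq ▸ hm) hf)

theorem foldr_replicate_pderiv (i : Fin n) (k : ℕ) (f : Rn n → ℝ) :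
    (List.replicate k i).foldr pderiv f = (pderiv i)^[k] f := by
  induction k with
  | zero => rfl
  | succ k ih => rw [List.replicate_succ, List.foldr_cons, ih, Function.iterate_succ_apply']

theorem multiDeriv_eq_listDeriv (β : Fin n → ℕ) (f : Rn n → ℝ) :
    multiDeriv β f = listDeriv ((List.finRange n).flatMap fun i => List.replicate (β i) i) f := by
  unfold multiDeriv listDeriv
  induction List.finRange n with
  | nil => rfl
  | cons i l ih =>
    rw [List.foldr_cons, ih, List.flatMap_cons, List.foldr_append, foldr_replicate_pderiv]

theorem perm_flatMap_replicate_count (l : List (Fin n)) :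
    l.Perm ((List.finRange n).flatMap fun i => List.replicate (l.count i) i) := by
  rw [List.perm_iff_count]
  intro a
  rw [List.count_flatMap]
  have : (List.map (List.count a ∘ fun i => List.replicate (l.count i) i) (List.finRange n)).sum
      = ∑ i, if i = a then l.count i else 0 := by
    rw [← List.sum_ofFn, List.ofFn_eq_map]
    congr 1
    refine List.map_congr_left fun i _ => ?_
    simp [List.count_replicate]
  rw [this]; simp

theorem sum_count_eq_length (l : List (Fin n)) : ∑ i, l.count i = l.length := by
  have h := (perm_flatMap_replicate_count l).length_eq
  rw [h, List.length_flatMap, ← List.sum_ofFn, List.ofFn_eq_map]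
  simp

theorem multiDeriv_count_eqOn {U : Set (Rn n)} (hU : IsOpen U) {f : Rn n → ℝ} (l : List (Fin n))
    (hf : ContDiffOn ℝ l.length f U) :
    Set.EqOn (multiDeriv (fun i => l.count i) f) (listDeriv l f) U := by
  rw [multiDeriv_eq_listDeriv]
  exact (listDeriv_perm hU (perm_flatMap_replicate_count l) _ le_rfl hf).symm

theorem abs_dirDeriv_sub_le (v y z : Rn n) {B : ℝ} :
    ∀ (k : ℕ) (f : Rn n → ℝ), (∀ l : List (Fin n), l.length = k →
      |listDeriv l f y - listDeriv l f z| ≤ B) →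
      |dirDeriv k v f y - dirDeriv k v f z| ≤ B * (∑ i, |v i|) ^ k
  | 0, f, h => by simpa [dirDeriv, listDeriv] using h [] rfl
  | k + 1, f, h => by
      have ih : ∀ i, |dirDeriv k v (pderiv i f) y - dirDeriv k v (pderiv i f) z|
          ≤ B * (∑ i, |v i|) ^ k := fun i => abs_dirDeriv_sub_le v y z k (pderiv i f)
        fun l hl => by
          simpa [listDeriv_append_singleton] using h (l ++ [i]) (by simp [hl])
      simp only [dirDeriv]
      rw [← Finset.sum_sub_distrib]
      calc _ ≤ ∑ i, |v i| * (B * (∑ i, |v i|) ^ k) := by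
            refine (Finset.abs_sum_le_sum_abs _ _).trans (Finset.sum_le_sum fun i _ => ?_)
            rw [← mul_sub, abs_mul]
            exact mul_le_mul_of_nonneg_left (ih i) (abs_nonneg _)
        _ = _ := by rw [← Finset.sum_mul]; ring

theorem dirDeriv_eq_zero (v z : Rn n) :
    ∀ (k : ℕ) (f : Rn n → ℝ), (∀ l : List (Fin n), listDeriv l f z = 0) → dirDeriv k v f z = 0
  | 0, f, h => h []
  | k + 1, f, h => Finset.sum_eq_zero fun i _ => by
      rw [dirDeriv_eq_zero v z k (pderiv i f) fun l => by
        rw [← listDeriv_append_singleton]; exact h _, mul_zero]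

theorem eq_sum_coord_smul_single (v : Rn n) :
    v = ∑ i, v i • (EuclideanSpace.single i (1 : ℝ) : Rn n) := by
  ext j; simp [Finset.sum_apply, Pi.single_apply]

theorem norm_le_sum_abs (v : Rn n) : ‖v‖ ≤ ∑ i, |v i| := by
  conv_lhs => rw [eq_sum_coord_smul_single v]
  refine (norm_sum_le _ _).trans (Finset.sum_le_sum fun i _ => ?_)
  simp [norm_smul]

theorem hasDerivAt_dirDeriv {U : Set (Rn n)} (hU : IsOpen U) (z v : Rn n) {s : ℝ}
    (hs : z + s • v ∈ U) :
    ∀ (k : ℕ) (f : Rn n → ℝ), ContDiffOn ℝ (k + 1 : ℕ) f U →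
      HasDerivAt (fun s : ℝ => dirDeriv k v f (z + s • v)) (dirDeriv (k + 1) v f (z + s • v)) s
  | 0, f, hf => by
      have hd : HasFDerivAt f (fderiv ℝ f (z + s • v)) (z + s • v) :=
        ((hf.contDiffAt (hU.mem_nhds hs)).differentiableAt (by simp)).hasFDerivAt
      have hline : HasDerivAt (fun s : ℝ => z + s • v) v s := by
        simpa using ((hasDerivAt_id s).smul_const v).const_add z
      refine (hd.comp_hasDerivAt s hline).congr_deriv ?_
      have : ∀ A : Rn n →L[ℝ] ℝ, A v = ∑ i, v i * A (EuclideanSpace.single i 1) := by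
        intro A
        conv_lhs => rw [eq_sum_coord_smul_single v, map_sum]
        simp
      exact this _
  | k + 1, f, hf => by
      have h : ∀ i, HasDerivAt (fun s : ℝ => v i * dirDeriv k v (pderiv i f) (z + s • v))
          (v i * dirDeriv (k + 1) v (pderiv i f) (z + s • v)) s := fun i =>
        (hasDerivAt_dirDeriv hU z v hs k (pderiv i f) (contDiffOn_pderiv hU hf i)).const_mul _
      exact HasDerivAt.fun_sum fun i _ => h i

/-- A one-variable Taylor estimate for a chain of functions `G k` with `G k' = G (k+1)`. -/
theorem abs_taylor_chain_le {B : ℝ} (c : ℝ) :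
    ∀ (m : ℕ) (G : ℕ → ℝ → ℝ),
      (∀ k < m, ∀ s ∈ Set.Icc (0 : ℝ) 1, HasDerivAt (G k) (G (k + 1) s) s) →
      (∀ s ∈ Set.Icc (0 : ℝ) 1, |G m s - c| ≤ B) → ∀ s ∈ Set.Icc (0 : ℝ) 1,
      |G 0 s - (∑ k ∈ Finset.range m, G k 0 * (s ^ k / k.factorial)
        + c * (s ^ m / m.factorial))| ≤ B
  | 0, G, _, h, s, hs => by simpa using h s hs
  | m + 1, G, hG, h, s, hs => by
      have hB : 0 ≤ B := (abs_nonneg _).trans (h s hs)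
      have ih := abs_taylor_chain_le c m (fun k => G (k + 1))
        (fun k hk => hG (k + 1) (by omega)) h
      set H : ℝ → ℝ := fun s => G 0 s - (∑ k ∈ Finset.range (m + 1), G k 0 * (s ^ k / k.factorial)
        + c * (s ^ (m + 1) / (m + 1).factorial)) with hH
      have hpow : ∀ (k : ℕ) (u : ℝ), HasDerivAt (fun s : ℝ => s ^ (k + 1) / (k + 1).factorial)
          (u ^ k / k.factorial) u := by
        intro k u
        refine ((hasDerivAt_pow (k + 1) u).div_const ((k + 1).factorial : ℝ)).congr_deriv ?_
        rw [Nat.factorial_succ]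
        have : (k.factorial : ℝ) ≠ 0 := by positivity
        push_cast
        field_simp
      have hder : ∀ u ∈ Set.Icc (0 : ℝ) 1, HasDerivWithinAt H
          (G 1 u - (∑ k ∈ Finset.range m, G (k + 1) 0 * (u ^ k / k.factorial)
            + c * (u ^ m / m.factorial))) (Set.Icc 0 1) u := by
        intro u hu
        refine HasDerivAt.hasDerivWithinAt ?_
        refine (hG 0 (by omega) u hu).fun_sub (HasDerivAt.fun_add ?_ ((hpow m u).const_mul c))
        simp_rw [Finset.sum_range_succ']
        have hs0 : HasDerivAt (fun s : ℝ => ∑ k ∈ Finset.range m,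
            G (k + 1) 0 * (s ^ (k + 1) / (k + 1).factorial))
            (∑ k ∈ Finset.range m, G (k + 1) 0 * (u ^ k / k.factorial)) u :=
          HasDerivAt.fun_sum fun k _ => (hpow k u).const_mul _
        simpa using hs0.add_const (G 0 0 * (1 / 1))
      have h0 : H 0 = 0 := by
        simp [hH, Finset.sum_range_succ']
      have := (convex_Icc (0 : ℝ) 1).norm_image_sub_le_of_norm_hasDerivWithin_le hder
        (fun u hu => ih u hu) (Set.left_mem_Icc.2 zero_le_one) hs
      rw [h0, sub_zero, sub_zero, Real.norm_eq_abs, Real.norm_eq_abs, abs_of_nonneg hs.1] at this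
      exact this.trans (by nlinarith [hs.2])

theorem abs_taylor_dirDeriv_le {U : Set (Rn n)} (hU : IsOpen U) {f : Rn n → ℝ} {m : ℕ}
    (hf : ContDiffOn ℝ m f U) (z v : Rn n) (hseg : ∀ s ∈ Set.Icc (0 : ℝ) 1, z + s • v ∈ U)
    {B c : ℝ} (hB : ∀ s ∈ Set.Icc (0 : ℝ) 1, |dirDeriv m v f (z + s • v) - c| ≤ B) :
    |f (z + v) - (∑ k ∈ Finset.range m, dirDeriv k v f z / k.factorial
      + c / m.factorial)| ≤ B := by
  have := abs_taylor_chain_le c m (fun k s => dirDeriv k v f (z + s • v))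
    (fun k hk s hs => hasDerivAt_dirDeriv hU z v (hseg s hs) k f
      (hf.of_le (by norm_cast))) hB 1 (Set.right_mem_Icc.2 zero_le_one)
  simpa [dirDeriv, ← div_eq_mul_inv] using this

/-- The space of polynomial functions on `ℝⁿ` of degree less than `k`. -/
def polyLT (n k : ℕ) : Submodule ℝ (Rn n → ℝ) :=
  Submodule.span ℝ {p | ∃ β : Fin n → ℕ, ∑ i, β i < k ∧ p = fun x => ∏ i, x i ^ β i}

theorem polyLT_mono {j k : ℕ} (h : j ≤ k) : polyLT n j ≤ polyLT n k :=
  Submodule.span_mono fun _ ⟨β, hβ, hp⟩ => ⟨β, hβ.trans_le h, hp⟩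

theorem const_mem_polyLT (b : ℝ) : (fun _ => b) ∈ polyLT n 1 := by
  have h : (fun _ => 1 : Rn n → ℝ) ∈ polyLT n 1 :=
    Submodule.subset_span ⟨0, by simp, by simp⟩
  simpa [Pi.smul_def] using (polyLT n 1).smul_mem b h

theorem coord_mul_mem_polyLT {k : ℕ} {p : Rn n → ℝ} (hp : p ∈ polyLT n k) (i : Fin n) :
    (fun x => x i * p x) ∈ polyLT n (k + 1) := by
  induction hp using Submodule.span_induction with
  | mem p hp =>
    obtain ⟨β, hβ, rfl⟩ := hp
    refine Submodule.subset_span ⟨β + Pi.single i 1, ?_, ?_⟩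
    · simp [Finset.sum_add_distrib]; omega
    · funext x
      simp only [Pi.add_apply, pow_add, Finset.prod_mul_distrib]
      rw [mul_comm]
      congr 1
      rw [Finset.prod_eq_single i] <;> simp +contextual
  | zero =>
    convert (polyLT n (k + 1)).zero_mem using 1
    funext x; simp
  | add p q _ _ hp hq =>
    convert Submodule.add_mem _ hp hq using 1
    funext x; simp [mul_add]
  | smul b p _ hp =>
    convert Submodule.smul_mem _ b hp using 1
    funext x; simp; ring

theorem dirDeriv_affine_mem_polyLT (α : ℝ) (b : Fin n → ℝ) (v : Rn n → Rn n)
    (hv : ∀ y i, v y i = α * y i + b i) (z : Rn n) :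
    ∀ (k : ℕ) (f : Rn n → ℝ), (fun y => dirDeriv k (v y) f z) ∈ polyLT n (k + 1)
  | 0, f => const_mem_polyLT (f z)
  | k + 1, f => by
      have ih := fun i => dirDeriv_affine_mem_polyLT α b v hv z k (pderiv i f)
      have : (fun y => dirDeriv (k + 1) (v y) f z) = ∑ i,
          (α • (fun y : Rn n => y i * dirDeriv k (v y) (pderiv i f) z)
            + b i • (fun y : Rn n => dirDeriv k (v y) (pderiv i f) z)) := by
        funext y
        simp only [dirDeriv, hv, Finset.sum_apply, Pi.add_apply, Pi.smul_apply, smul_eq_mul]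
        exact Finset.sum_congr rfl fun i _ => by ring
      rw [this]
      exact Submodule.sum_mem _ fun i _ => Submodule.add_mem _
        (Submodule.smul_mem _ _ (coord_mul_mem_polyLT (ih i) i))
        (Submodule.smul_mem _ _ (polyLT_mono (Nat.le_succ _) (ih i)))

theorem integrable_and_integral_polyLT_mul_eq_zero {k : ℕ} {F : Rn n → ℝ}
    (hF : ∀ β : Fin n → ℕ, ∑ i, β i < k →
      Integrable (fun x => (∏ i, x i ^ β i) * F x) ∧ ∫ x, (∏ i, x i ^ β i) * F x = 0)
    {p : Rn n → ℝ} (hp : p ∈ polyLT n k) :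
    Integrable (fun x => p x * F x) ∧ ∫ x, p x * F x = 0 := by
  induction hp using Submodule.span_induction with
  | mem p hp =>
    obtain ⟨β, hβ, rfl⟩ := hp
    exact hF β hβ
  | zero => simp
  | add p q _ _ hp hq =>
    simp only [Pi.add_apply, add_mul]
    exact ⟨hp.1.add hq.1, by rw [integral_add hp.1 hq.1, hp.2, hq.2, add_zero]⟩
  | smul b p _ hp =>
    simp only [Pi.smul_apply, smul_eq_mul, mul_assoc]
    exact ⟨hp.1.const_mul b, by rw [integral_const_mul, hp.2, mul_zero]⟩

theorem exists_abs_dirDeriv_le :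
    ∀ (k : ℕ) (f : Rn n → ℝ), ContDiff ℝ (⊤ : ℕ∞) f → HasCompactSupport f →
      ∃ M : ℝ, 0 ≤ M ∧ ∀ v w : Rn n, |dirDeriv k v f w| ≤ M * (∑ i, |v i|) ^ k
  | 0, f, hf, hc => by
      obtain ⟨M, hM⟩ := hc.exists_bound_of_continuous hf.continuous
      exact ⟨M, (norm_nonneg _).trans (hM 0), fun v w => by simpa [dirDeriv] using hM w⟩
  | k + 1, f, hf, hc => by
      have ih := fun i => exists_abs_dirDeriv_le k (pderiv i f)
        ((hf.fderiv_right (m := (⊤ : ℕ∞)) (by simp)).clm_apply contDiff_const)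
        (hc.fderiv_apply ℝ _)
      choose M hM hb using ih
      refine ⟨∑ i, M i, Finset.sum_nonneg fun i _ => hM i, fun v w => ?_⟩
      have hS : 0 ≤ ∑ i, |v i| := Finset.sum_nonneg fun i _ => abs_nonneg _
      calc |dirDeriv (k + 1) v f w| ≤ ∑ i, |v i| * ((∑ i, M i) * (∑ i, |v i|) ^ k) := by
            refine (Finset.abs_sum_le_sum_abs _ _).trans (Finset.sum_le_sum fun i _ => ?_)
            rw [abs_mul]
            refine mul_le_mul_of_nonneg_left ((hb i v w).trans ?_) (abs_nonneg _)
            exact mul_le_mul_of_nonneg_right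
              (Finset.single_le_sum (fun j _ => hM j) (Finset.mem_univ i)) (pow_nonneg hS k)
        _ = _ := by rw [← Finset.sum_mul]; ring

theorem ae_pderiv_eq_zero {f : Rn n → ℝ} (hf : ContDiff ℝ (⊤ : ℕ∞) f) (i : Fin n) :
    ∀ᵐ w, f w = 0 → pderiv i f w = 0 := by
  set e : Rn n := EuclideanSpace.single i 1 with he
  have hs : MeasurableSet {w | f w = 0} := (isClosed_eq hf.continuous continuous_const).measurableSet
  have happ : ApproximatesLinearOn (fun w => f w • e) (0 : Rn n →L[ℝ] Rn n) {w | f w = 0} 0 := by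
    intro x hx y hy
    simp only [Set.mem_ofPred_eq] at hx hy
    simp [hx, hy]
  have h := happ.norm_fderiv_sub_le (μ := volume) hs (fun w => (fderiv ℝ f w).smulRight e)
    fun w _ => (((hf.differentiable (by simp)) w).hasFDerivAt.smul_const e).hasFDerivWithinAt
  rw [ae_restrict_iff' hs] at h
  filter_upwards [h] with w hw h0
  have hz := hw h0
  simp only [sub_zero, nonpos_iff_eq_zero, nnnorm_eq_zero] at hz
  have := congrArg (fun A : Rn n →L[ℝ] Rn n => A e i) hz
  simpa [pderiv, he] using this

theorem contDiff_listDeriv {f : Rn n → ℝ} (hf : ContDiff ℝ (⊤ : ℕ∞) f) :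
    ∀ l : List (Fin n), ContDiff ℝ (⊤ : ℕ∞) (listDeriv l f)
  | [] => hf
  | _ :: l => ((contDiff_listDeriv hf l).fderiv_right (m := (⊤ : ℕ∞)) (by simp)).clm_apply
      contDiff_const

theorem ae_forall_listDeriv_eq_zero {f : Rn n → ℝ} (hf : ContDiff ℝ (⊤ : ℕ∞) f) :
    ∀ᵐ w, f w = 0 → ∀ l : List (Fin n), listDeriv l f w = 0 := by
  have h : ∀ l : List (Fin n), ∀ᵐ w, f w = 0 → listDeriv l f w = 0 := by
    intro l
    induction l with
    | nil => exact Eventually.of_forall fun w h => h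
    | cons i l ih =>
      filter_upwards [ih, ae_pderiv_eq_zero (contDiff_listDeriv hf l) i] with w h₁ h₂ h0
      exact h₂ (h₁ h0)
  filter_upwards [ae_all_iff.2 h] with w hw h0 l
  exact hw l h0

theorem norm_sub_le_of_mem_stdCube {c y : Rn n} {r : ℝ} (hy : y ∈ stdCube c r) :
    ∑ i, |(y - c) i| ≤ n * r := by
  calc ∑ i, |(y - c) i| ≤ ∑ _i : Fin n, r := Finset.sum_le_sum fun i _ => by simpa using hy i
    _ = n * r := by simp

theorem stdCube_eq_preimage (c : Rn n) (r : ℝ) :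
    stdCube c r = WithLp.ofLp ⁻¹' Set.pi Set.univ fun i => Set.Icc (c i - r) (c i + r) := by
  ext y
  simp only [stdCube, Set.mem_preimage, Set.mem_univ_pi, Set.mem_Icc, Set.mem_ofPred_eq, abs_le]
  exact forall_congr' fun i => by constructor <;> rintro ⟨h₁, h₂⟩ <;> constructor <;> linarith

theorem isClosed_stdCube (c : Rn n) (r : ℝ) : IsClosed (stdCube c r) := by
  rw [stdCube_eq_preimage]
  exact (isClosed_set_pi fun i _ => isClosed_Icc).preimage (PiLp.continuous_ofLp 2 _)

theorem isCompact_stdCube (c : Rn n) (r : ℝ) : IsCompact (stdCube c r) := by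
  refine (isCompact_closedBall c (n * r)).of_isClosed_subset (isClosed_stdCube c r) fun y hy => ?_
  rw [Metric.mem_closedBall, dist_eq_norm]
  exact (norm_le_sum_abs _).trans (norm_sub_le_of_mem_stdCube hy)

theorem volume_stdCube (c : Rn n) {r : ℝ} (hr : 0 ≤ r) :
    volume (stdCube c r) = ENNReal.ofReal ((2 * r) ^ n) := by
  rw [stdCube_eq_preimage, (PiLp.volume_preserving_ofLp (Fin n)).measure_preimage
    (MeasurableSet.univ_pi fun i => measurableSet_Icc).nullMeasurableSet, volume_pi_pi]
  simp only [Real.volume_Icc]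
  have : ∀ i : Fin n, c i + r - (c i - r) = 2 * r := fun i => by ring
  simp [this, ENNReal.ofReal_pow (by linarith : 0 ≤ 2 * r)]

theorem ofReal_le_fracMax_indicator {c x : Rn n} {r d : ℝ} (hr : 0 < r) (hrd : r ≤ d)
    (hx : ‖x - c‖ ≤ d) :
    ENNReal.ofReal ((r / d) ^ n) ≤ fracMax 0 ((stdCube c r).indicator fun _ => (1 : ℝ)) x := by
  have hd : 0 < d := hr.trans_le hrd
  have hxd : x ∈ stdCube c d := fun i => by
    have := (PiLp.norm_apply_le (x - c) i).trans hx
    simpa using this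
  refine le_trans ?_ (le_iSup₂ (f := fun (Q : Set (Rn n)) (_ : IsCube Q ∧ x ∈ Q) =>
    volume Q ^ ((0 : ℝ) / (n : ℝ)) * ((∫⁻ y in Q, ENNReal.ofReal
      |(stdCube c r).indicator (fun _ => (1 : ℝ)) y|) / volume Q))
    (stdCube c d) ⟨⟨c, d, hd, rfl⟩, hxd⟩)
  have hsub : stdCube c r ⊆ stdCube c d := fun y hy i => (hy i).trans hrd
  have hint : ∫⁻ y in stdCube c d, ENNReal.ofReal
      |(stdCube c r).indicator (fun _ => (1 : ℝ)) y| = volume (stdCube c r) := by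
    have : (fun y => ENNReal.ofReal |(stdCube c r).indicator (fun _ => (1 : ℝ)) y|) =
        (stdCube c r).indicator 1 := by
      funext y
      by_cases hy : y ∈ stdCube c r <;> simp [hy]
    rw [this, lintegral_indicator_one (isClosed_stdCube c r).measurableSet,
      Measure.restrict_apply (isClosed_stdCube c r).measurableSet,
      Set.inter_eq_self_of_subset_left hsub]
  simp only [zero_div, ENNReal.rpow_zero, one_mul]
  rw [hint, volume_stdCube c hr.le, volume_stdCube c hd.le,
    ← ENNReal.ofReal_div_of_pos (by positivity)]
  refine ENNReal.ofReal_le_ofReal (le_of_eq ?_)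
  rw [← div_pow, mul_div_mul_left _ _ two_ne_zero]

theorem lintegral_one_add_norm_scaled (p : ℝ) (hp : (n : ℝ) < p) (c : Rn n) {r : ℝ} (hr : 0 < r) :
    ∫⁻ y : Rn n, ENNReal.ofReal ((1 + ‖y - c‖ / r) ^ (-p)) =
      ENNReal.ofReal (r ^ n * ∫ y : Rn n, (1 + ‖y‖) ^ (-p)) := by
  have hint : Integrable fun y : Rn n => (1 + ‖y‖) ^ (-p) :=
    integrable_one_add_norm (by simpa using hp)
  have hint' : Integrable fun y : Rn n => (1 + ‖r⁻¹ • (y - c)‖) ^ (-p) :=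
    (hint.comp_smul (inv_ne_zero hr.ne')).comp_sub_right c
  have heq : ∀ y : Rn n, (1 + ‖y - c‖ / r) ^ (-p) = (1 + ‖r⁻¹ • (y - c)‖) ^ (-p) := fun y => by
    rw [norm_smul, norm_inv, Real.norm_of_nonneg hr.le, div_eq_inv_mul]
  simp_rw [heq]
  rw [← ofReal_integral_eq_lintegral_ofReal hint' (Eventually.of_forall fun y => by positivity),
    integral_sub_right_eq_self (fun y : Rn n => (1 + ‖r⁻¹ • y‖) ^ (-p)) c,
    Measure.integral_comp_smul volume (fun y : Rn n => (1 + ‖y‖) ^ (-p))]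
  simp [abs_of_pos hr]

/-- Weighted estimate for a function which is square integrable and decays away from a cube. -/
theorem exists_lintegral_mul_le (hn : 0 < n) (m : ℕ) {δ D W : ℝ} (hδ : 0 < δ) (hD : 0 ≤ D)
    (hW : 0 ≤ W) :
    ∃ C : ℝ, 0 ≤ C ∧ ∀ (g : Rn n → ℝ) (c : Rn n) (r : ℝ), 0 < r →
      (∀ y, 2 * (n * r) ≤ ‖y - c‖ → |g y| ≤ D * (r / ‖y - c‖) ^ ((n : ℝ) + m + δ)) →
      ∫⁻ y, ENNReal.ofReal (g y ^ 2) ≤ ENNReal.ofReal (W * r ^ n) →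
      ∀ (B : ℝ) (G : Rn n → ℝ), 0 ≤ B → (∀ y, |G y| ≤ B * (‖y - c‖ + 2 * (n * r)) ^ m) →
        ∫⁻ y, ENNReal.ofReal |G y * g y| ≤ ENNReal.ofReal (C * B * r ^ (n + m)) := by
  set p : ℝ := n + δ with hp
  have hp0 : 0 < p := by positivity
  set J : ℝ := ∫ y : Rn n, (1 + ‖y‖) ^ (-p) with hJ
  have hJ0 : 0 ≤ J := integral_nonneg fun y => by positivity
  set C₁ : ℝ := 2 ^ m * D * 2 ^ p + (4 * n) ^ m * (1 + 2 * n) ^ p with hC₁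
  have hC₁0 : 0 ≤ C₁ := by positivity
  have hn1 : (1 : ℝ) ≤ n := by exact_mod_cast hn
  refine ⟨C₁ * J + (4 * n) ^ m * W, by positivity, ?_⟩
  intro g c r hr hdec hL2 B G hB hG
  have hpt : ∀ y, |G y * g y| ≤ B * r ^ m * C₁ * (1 + ‖y - c‖ / r) ^ (-p)
      + B * r ^ m * (4 * n) ^ m * g y ^ 2 := by
    intro y
    set u := ‖y - c‖ / r with hu
    have hu0 : 0 ≤ u := by positivity
    have hyu : ‖y - c‖ = r * u := by rw [hu]; field_simp
    have hj0 : 0 ≤ (1 + u) ^ (-p) := by positivity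
    rw [abs_mul]
    rcases le_or_gt (2 * (n * r)) ‖y - c‖ with h | h
    · have hu1 : 1 ≤ u := by
        rw [hu, le_div_iff₀ hr]; nlinarith
      have hu0' : 0 < u := by linarith
      have h1 : |G y| ≤ B * (2 ^ m * r ^ m * u ^ m) := by
        refine (hG y).trans (mul_le_mul_of_nonneg_left ?_ hB)
        rw [← mul_pow, ← mul_pow]
        exact pow_le_pow_left₀ (by positivity) (by linarith) m
      have h2 : |g y| ≤ D * (u ^ m)⁻¹ * u ^ (-p) := by
        refine (hdec y h).trans (le_of_eq ?_)
        have : r / ‖y - c‖ = u⁻¹ := by rw [hu, inv_div]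
        rw [this, Real.inv_rpow hu0, ← Real.rpow_neg hu0, mul_assoc, ← Real.rpow_natCast u m,
          ← Real.rpow_neg hu0, ← Real.rpow_add hu0']
        congr 2; rw [hp]; ring
      have h3 : u ^ (-p) ≤ 2 ^ p * (1 + u) ^ (-p) := by
        rw [Real.rpow_neg hu0, Real.rpow_neg (by positivity), ← div_eq_mul_inv,
          le_div_iff₀ (by positivity), ← div_eq_inv_mul, div_le_iff₀ (by positivity),
          ← Real.mul_rpow zero_le_two hu0]
        exact Real.rpow_le_rpow (by positivity) (by linarith) hp0.le
      have h4 : |G y| * |g y| ≤ B * (2 ^ m * r ^ m * u ^ m) *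
          (D * (u ^ m)⁻¹ * (2 ^ p * (1 + u) ^ (-p))) :=
        mul_le_mul h1 (h2.trans (mul_le_mul_of_nonneg_left h3 (by positivity)))
          (abs_nonneg _) (by positivity)
      have h5 : B * (2 ^ m * r ^ m * u ^ m) * (D * (u ^ m)⁻¹ * (2 ^ p * (1 + u) ^ (-p))) =
          B * r ^ m * (2 ^ m * D * 2 ^ p) * (1 + u) ^ (-p) := by
        have : u ^ m ≠ 0 := by positivity
        field_simp
      rw [h5] at h4
      refine h4.trans ?_
      have h6 : 0 ≤ B * r ^ m * (4 * n) ^ m * g y ^ 2 := by positivity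
      have h7 : B * r ^ m * (2 ^ m * D * 2 ^ p) * (1 + u) ^ (-p) ≤
          B * r ^ m * C₁ * (1 + u) ^ (-p) := by
        gcongr
        rw [hC₁]
        have : (0 : ℝ) ≤ (4 * n) ^ m * (1 + 2 * n) ^ p := by positivity
        linarith
      linarith
    · have hu2 : u ≤ 2 * n := by
        rw [hu, div_le_iff₀ hr]; linarith
      have h1 : |G y| ≤ B * (r ^ m * (4 * n) ^ m) := by
        refine (hG y).trans (mul_le_mul_of_nonneg_left ?_ hB)
        rw [← mul_pow]
        exact pow_le_pow_left₀ (by positivity) (by linarith) m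
      have h2 : |g y| ≤ 1 + g y ^ 2 := by
        nlinarith [sq_nonneg (|g y| - 1), sq_abs (g y), sq_nonneg (g y)]
      have h3 : 1 ≤ (1 + 2 * n) ^ p * (1 + u) ^ (-p) := by
        rw [Real.rpow_neg (by positivity), ← div_eq_mul_inv, one_le_div (by positivity)]
        exact Real.rpow_le_rpow (by positivity) (by linarith) hp0.le
      have h4 : |G y| * |g y| ≤ B * (r ^ m * (4 * n) ^ m) *
          ((1 + 2 * n) ^ p * (1 + u) ^ (-p) + g y ^ 2) :=
        mul_le_mul h1 (by linarith) (abs_nonneg _) (by positivity)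
      refine h4.trans ?_
      have h5 : 0 ≤ B * r ^ m * (2 ^ m * D * 2 ^ p) * (1 + u) ^ (-p) := by positivity
      rw [hC₁]
      nlinarith
  calc ∫⁻ y, ENNReal.ofReal |G y * g y|
      ≤ ∫⁻ y, (ENNReal.ofReal (B * r ^ m * C₁) * ENNReal.ofReal ((1 + ‖y - c‖ / r) ^ (-p))
        + ENNReal.ofReal (B * r ^ m * (4 * n) ^ m) * ENNReal.ofReal (g y ^ 2)) := by
        refine lintegral_mono fun y => ?_
        rw [← ENNReal.ofReal_mul (by positivity), ← ENNReal.ofReal_mul (by positivity),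
          ← ENNReal.ofReal_add (by positivity) (by positivity)]
        exact ENNReal.ofReal_le_ofReal (hpt y)
    _ = ENNReal.ofReal (B * r ^ m * C₁) * ENNReal.ofReal (r ^ n * J)
        + ENNReal.ofReal (B * r ^ m * (4 * n) ^ m) * ∫⁻ y, ENNReal.ofReal (g y ^ 2) := by
        rw [lintegral_add_left (by fun_prop), lintegral_const_mul' _ _ ENNReal.ofReal_ne_top,
          lintegral_const_mul' _ _ ENNReal.ofReal_ne_top,
          lintegral_one_add_norm_scaled p (by rw [hp]; linarith) c hr]
    _ ≤ ENNReal.ofReal (B * r ^ m * C₁) * ENNReal.ofReal (r ^ n * J)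
        + ENNReal.ofReal (B * r ^ m * (4 * n) ^ m) * ENNReal.ofReal (W * r ^ n) := by
        gcongr
    _ = _ := by
        rw [← ENNReal.ofReal_mul (by positivity), ← ENNReal.ofReal_mul (by positivity),
          ← ENNReal.ofReal_add (by positivity) (by positivity)]
        congr 1
        ring

theorem IsNAtom.integrable_continuous_mul {N : ℕ} {a : Rn n → ℝ} {c : Rn n} {r : ℝ}
    (ha : IsNAtom N a (stdCube c r)) {g : Rn n → ℝ} (hg : ContinuousOn g (stdCube c r)) :
    Integrable fun y => g y * a y := by
  obtain ⟨hm, hb, -, hs, -⟩ := ha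
  have hsup : Function.support (fun y => g y * a y) ⊆ stdCube c r :=
    (Function.support_mul_subset_right g a).trans hs
  rw [← integrableOn_iff_integrable_of_support_subset hsup]
  have hint : IntegrableOn a (stdCube c r) :=
    Measure.integrableOn_of_bounded (M := 1) (isCompact_stdCube c r).measure_lt_top.ne
      hm.aestronglyMeasurable (Eventually.of_forall fun y => by simpa using hb y)
  exact hint.continuousOn_mul hg (isCompact_stdCube c r)

theorem IsNAtom.integrable_and_integral_polyLT_mul_eq_zero {N : ℕ} {a : Rn n → ℝ} {c : Rn n}
    {r : ℝ} (ha : IsNAtom N a (stdCube c r)) {p : Rn n → ℝ} (hp : p ∈ polyLT n (N + 1)) :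
    Integrable (fun y => p y * a y) ∧ ∫ y, p y * a y = 0 :=
  _root_.integrable_and_integral_polyLT_mul_eq_zero (fun β hβ =>
    ⟨ha.integrable_continuous_mul (by fun_prop), ha.2.2.2.2 β (by omega)⟩) hp

theorem IsNAtom.tsupport_subset {N : ℕ} {a : Rn n → ℝ} {c : Rn n} {r : ℝ}
    (ha : IsNAtom N a (stdCube c r)) : tsupport a ⊆ stdCube c r :=
  closure_minimal ha.2.2.2.1 (isClosed_stdCube c r)

theorem notMem_stdCube_of_lt_norm {c y : Rn n} {r : ℝ} (h : n * r < ‖y - c‖) :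
    y ∉ stdCube c r := fun hy =>
  absurd ((norm_le_sum_abs _).trans (norm_sub_le_of_mem_stdCube hy)) (not_le.2 h)

theorem KernelHigherSmooth.exists_abs_integral_le {K : Rn n → Rn n → ℝ} {δ C : ℝ} {m : ℕ}
    (hn : 0 < n) (hδ : 0 < δ) (hC : 0 < C) (hK : KernelHigherSmooth K δ m C) :
    ∃ D : ℝ, 0 ≤ D ∧ ∀ (a : Rn n → ℝ) (c : Rn n) (r : ℝ), 0 < r → IsNAtom m a (stdCube c r) →
      ∀ x, 2 * (n * r) ≤ ‖x - c‖ →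
        |∫ y, K x y * a y| ≤ D * (r / ‖x - c‖) ^ ((n : ℝ) + m + δ) := by
  refine ⟨C * (n : ℝ) ^ δ * (n : ℝ) ^ m * 2 ^ n, by positivity, ?_⟩
  intro a c r hr ha x hx
  have hnr : 0 < n * r := by positivity
  have hd : 0 < ‖x - c‖ := by linarith
  have hU : IsOpen ({x}ᶜ : Set (Rn n)) := isOpen_compl_singleton
  set P : Rn n → ℝ := fun y => ∑ k ∈ Finset.range m, dirDeriv k (y - c) (K x) c / k.factorial
    + dirDeriv m (y - c) (K x) c / m.factorial with hP
  have hPmem : P ∈ polyLT n (m + 1) := by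
    have h : ∀ k ≤ m, (fun y => dirDeriv k (y - c) (K x) c / k.factorial) ∈ polyLT n (m + 1) := by
      intro k hk
      have := polyLT_mono (by omega : k + 1 ≤ m + 1)
        (dirDeriv_affine_mem_polyLT 1 (fun i => -c i) (fun y => y - c)
          (fun y i => by simp [sub_eq_add_neg]) c k (K x))
      convert Submodule.smul_mem _ ((k.factorial : ℝ)⁻¹) this using 1
      funext y; simp [div_eq_inv_mul]
    have hsum : P = ∑ k ∈ Finset.range m, (fun y => dirDeriv k (y - c) (K x) c / k.factorial)
        + (fun y => dirDeriv m (y - c) (K x) c / m.factorial) := by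
      funext y; simp [hP]
    rw [hsum]
    exact Submodule.add_mem _
      (Submodule.sum_mem _ fun k hk => h k (Finset.mem_range.1 hk).le) (h m le_rfl)
  set B : ℝ := C * (n * r) ^ δ * ‖x - c‖ ^ (-((n : ℝ) + m + δ)) * (n * r) ^ m with hB
  have hB0 : 0 ≤ B := by positivity
  have hbound : ∀ y ∈ stdCube c r, |K x y - P y| ≤ B := by
    intro y hy
    have hS := norm_sub_le_of_mem_stdCube hy
    have hyc : ‖y - c‖ ≤ n * r := (norm_le_sum_abs _).trans hS
    have hsv : ∀ s ∈ Set.Icc (0 : ℝ) 1, ‖s • (y - c)‖ ≤ n * r := fun s hs => by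
      rw [norm_smul, Real.norm_of_nonneg hs.1]
      exact (mul_le_of_le_one_left (norm_nonneg _) hs.2).trans hyc
    have hxc : x ≠ c := by
      rintro rfl; simp at hd
    have hseg : ∀ s ∈ Set.Icc (0 : ℝ) 1, c + s • (y - c) ∈ ({x}ᶜ : Set (Rn n)) := by
      intro s hs h
      have h' : s • (y - c) = x - c := by
        rw [← (h : c + s • (y - c) = x)]; abel
      have := hsv s hs
      rw [h'] at this
      linarith
    have hT := abs_taylor_dirDeriv_le hU (hK.1 x) c (y - c) hseg
      (B := B) (c := dirDeriv m (y - c) (K x) c) ?_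
    · simpa [hP] using hT
    · intro s hs
      have hS0 : 0 ≤ ∑ i, |(y - c) i| := Finset.sum_nonneg fun i _ => abs_nonneg _
      refine (abs_dirDeriv_sub_le (y - c) (c + s • (y - c)) c
        (B := C * (n * r) ^ δ * ‖x - c‖ ^ (-((n : ℝ) + m + δ))) m (K x) ?_).trans ?_
      · intro l hl
        have hf : ContDiffOn ℝ l.length (K x) {x}ᶜ := hl ▸ hK.1 x
        have he := multiDeriv_count_eqOn hU l hf
        rw [← he (hseg s hs), ← he (show c ∈ ({x}ᶜ : Set (Rn n)) from fun h => hxc h.symm)]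
        refine (hK.2 _ ((sum_count_eq_length l).trans hl) x c (s • (y - c)) hxc
          ((hsv s hs).trans (by linarith))).trans ?_
        gcongr
        exact hsv s hs
      · exact mul_le_mul_of_nonneg_left (pow_le_pow_left₀ hS0 hS m) (by positivity)
  have hfin : |∫ y, K x y * a y| ≤ B * (2 * r) ^ n := by
    by_cases hint : Integrable fun y => K x y * a y
    · obtain ⟨hPi, hP0⟩ := ha.integrable_and_integral_polyLT_mul_eq_zero hPmem
      have heq : ∫ y, K x y * a y = ∫ y, (K x y - P y) * a y := by
        simp_rw [sub_mul]
        rw [integral_sub hint hPi, hP0, sub_zero]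
      have hbi : Integrable ((stdCube c r).indicator fun _ => B) := by
        rw [integrable_indicator_iff (isClosed_stdCube c r).measurableSet]
        exact integrableOn_const (isCompact_stdCube c r).measure_lt_top.ne
      rw [heq, ← Real.norm_eq_abs]
      refine (norm_integral_le_of_norm_le hbi (Eventually.of_forall fun y => ?_)).trans
        (le_of_eq ?_)
      · by_cases hy : y ∈ stdCube c r
        · rw [Set.indicator_of_mem hy, Real.norm_eq_abs, abs_mul]
          have := mul_le_mul (hbound y hy) (ha.2.1 y) (abs_nonneg _) hB0
          simpa using this
        · have : a y = 0 := by
            by_contra h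
            exact hy (ha.2.2.2.1 h)
          simp [hy, this]
      · rw [integral_indicator_const _ (isClosed_stdCube c r).measurableSet, measureReal_def,
          volume_stdCube c hr.le, ENNReal.toReal_ofReal (by positivity), smul_eq_mul, mul_comm]
    · rw [integral_undef hint, abs_zero]
      positivity
  refine hfin.trans (le_of_eq ?_)
  rw [hB, Real.div_rpow hr.le hd.le, Real.rpow_neg hd.le, Real.mul_rpow (by positivity) hr.le,
    Real.rpow_add hr, Real.rpow_add hr, Real.rpow_natCast, Real.rpow_natCast, mul_pow, mul_pow]
  field_simp

theorem continuousAt_integral_kernel {K : Rn n → Rn n → ℝ} {δ C₁ C₂ : ℝ} {N m : ℕ}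
    (hδ : 0 < δ) (hC₁ : 0 < C₁) (hsize : CZKernelSize K C₁) (hsmooth : CZKernelSmooth K δ C₁)
    (hK : KernelHigherSmooth K δ m C₂) {a : Rn n → ℝ} {c : Rn n} {r : ℝ}
    (ha : IsNAtom N a (stdCube c r)) {x₀ : Rn n} (hx₀ : n * r < ‖x₀ - c‖) :
    ContinuousAt (fun x => ∫ y, K x y * a y) x₀ := by
  set ε : ℝ := (‖x₀ - c‖ - n * r) / 2 with hε
  have hε0 : 0 < ε := by rw [hε]; linarith
  have hnhds : ∀ᶠ x in 𝓝 x₀, n * r + ε < ‖x - c‖ := by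
    refine ContinuousAt.eventually_lt continuousAt_const (by fun_prop) ?_
    rw [hε]; linarith
  have hfar : ∀ x, n * r + ε < ‖x - c‖ → ∀ y ∈ stdCube c r, ε ≤ ‖x - y‖ := by
    intro x hx y hy
    have h1 : ‖y - c‖ ≤ n * r := (norm_le_sum_abs _).trans (norm_sub_le_of_mem_stdCube hy)
    have h2 := norm_add_le (x - y) (y - c)
    rw [sub_add_sub_cancel] at h2
    linarith
  have hz : ∀ y, y ∉ stdCube c r → a y = 0 := fun y hy => by
    by_contra h
    exact hy (ha.2.2.2.1 h)
  refine continuousAt_of_dominated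
    (bound := (stdCube c r).indicator fun _ => C₁ * ε ^ (-(n : ℝ))) ?_ ?_ ?_ ?_
  · filter_upwards [hnhds] with x hx
    refine (ha.integrable_continuous_mul (g := K x) ((hK.1 x).continuousOn.mono ?_)).1
    intro y hy h
    have := hfar x hx y hy
    rw [(h : y = x), sub_self, norm_zero] at this
    linarith
  · filter_upwards [hnhds] with x hx
    refine Eventually.of_forall fun y => ?_
    by_cases hy : y ∈ stdCube c r
    · have hxy := hfar x hx y hy
      have hne : x ≠ y := by
        rintro rfl
        rw [sub_self, norm_zero] at hxy
        linarith
      rw [Set.indicator_of_mem hy, Real.norm_eq_abs, abs_mul]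
      have h1 : |K x y| ≤ C₁ * ε ^ (-(n : ℝ)) := (hsize x y hne).trans
        (mul_le_mul_of_nonneg_left
          (Real.rpow_le_rpow_of_nonpos hε0 hxy (by simp)) hC₁.le)
      have := mul_le_mul h1 (ha.2.1 y) (abs_nonneg _) (by positivity)
      simpa using this
    · simp [hz y hy, hy]
  · rw [integrable_indicator_iff (isClosed_stdCube c r).measurableSet]
    exact integrableOn_const (isCompact_stdCube c r).measure_lt_top.ne
  · refine Eventually.of_forall fun y => ?_
    by_cases hy : y ∈ stdCube c r
    · refine ContinuousAt.mul ?_ continuousAt_const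
      have hxy := hfar x₀ (by rw [hε]; linarith) y hy
      have hne : x₀ ≠ y := by
        rintro rfl
        rw [sub_self, norm_zero] at hxy
        linarith
      rw [ContinuousAt, tendsto_iff_dist_tendsto_zero]
      have hlim : Tendsto (fun x => C₁ * ‖x - x₀‖ ^ δ * ‖x₀ - y‖ ^ (-(n : ℝ) - δ)) (𝓝 x₀)
          (𝓝 0) := by
        have h : ContinuousAt (fun x => C₁ * ‖x - x₀‖ ^ δ * ‖x₀ - y‖ ^ (-(n : ℝ) - δ)) x₀ := by
          refine ContinuousAt.mul (ContinuousAt.mul continuousAt_const ?_) continuousAt_const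
          exact ContinuousAt.rpow_const (by fun_prop) (Or.inr hδ.le)
        simpa [ContinuousAt, Real.zero_rpow hδ.ne'] using h
      refine squeeze_zero' (Eventually.of_forall fun _ => dist_nonneg) ?_ hlim
      have hnear : ∀ᶠ x in 𝓝 x₀, ‖x - x₀‖ < ‖x₀ - y‖ / 2 :=
        ContinuousAt.eventually_lt (by fun_prop) continuousAt_const
          (by rw [sub_self, norm_zero]; linarith)
      filter_upwards [hnear] with x hx
      have := hsmooth x₀ y (x - x₀) hne hx.le
      rw [add_sub_cancel] at this
      rw [Real.dist_eq]
      linarith [abs_nonneg (K x₀ (y + (x - x₀)) - K x₀ y)]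
    · simp [hz y hy, continuousAt_const]

theorem L2Bounded.exists_lintegral_sq_le {T : (Rn n → ℝ) → Rn n → ℝ} (hT : L2Bounded T) :
    ∃ W : ℝ, 0 ≤ W ∧ ∀ (N : ℕ) (a : Rn n → ℝ) (c : Rn n) (r : ℝ), 0 < r →
      IsNAtom N a (stdCube c r) →
        ∫⁻ y, ENNReal.ofReal (T a y ^ 2) ≤ ENNReal.ofReal (W * r ^ n) := by
  obtain ⟨A, hA, hTA⟩ := hT
  refine ⟨A ^ 2 * 2 ^ n, by positivity, ?_⟩
  intro N a c r hr ha
  have hsq : ∀ f : Rn n → ℝ, weightedLp 2 (fun _ => 1) f =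
      (∫⁻ y, ENNReal.ofReal (f y ^ 2)) ^ (1 / 2 : ℝ) := by
    intro f
    simp only [weightedLp, ENNReal.ofReal_one, mul_one]
    congr 1
    refine lintegral_congr fun y => ?_
    rw [ENNReal.rpow_two, ← ENNReal.ofReal_pow (abs_nonneg _), sq_abs]
  have h := hTA a ha.1
  rw [hsq, hsq] at h
  have ha2 : ∫⁻ y, ENNReal.ofReal (a y ^ 2) ≤ ENNReal.ofReal ((2 * r) ^ n) := by
    rw [← volume_stdCube c hr.le, ← lintegral_indicator_one (isClosed_stdCube c r).measurableSet]
    refine lintegral_mono fun y => ?_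
    by_cases hy : y ∈ stdCube c r
    · rw [Set.indicator_of_mem hy, Pi.one_apply, ENNReal.ofReal_le_one]
      exact (sq_le_one_iff_abs_le_one _).2 (ha.2.1 y)
    · have : a y = 0 := by
        by_contra h
        exact hy (ha.2.2.2.1 h)
      simp [this]
  have h2 := ENNReal.rpow_le_rpow (h.trans (mul_le_mul_right
    (ENNReal.rpow_le_rpow ha2 (by norm_num : (0 : ℝ) ≤ 1 / 2)) _)) zero_le_two
  rw [ENNReal.mul_rpow_of_nonneg _ _ zero_le_two, ← ENNReal.rpow_mul, ← ENNReal.rpow_mul] at h2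
  norm_num at h2
  refine h2.trans (le_of_eq ?_)
  rw [← ENNReal.ofReal_pow hA.le, ← ENNReal.ofReal_mul (by positivity)]
  congr 1
  ring

theorem abs_integral_mollifier_le {φ g : Rn n → ℝ} (hφ : Integrable φ)
    (hφs : tsupport φ ⊆ Metric.ball 0 1) {x : Rn n} {t B : ℝ} (ht : 0 < t)
    (hg : ∀ y, ‖x - y‖ < t → |g y| ≤ B) :
    |∫ y, (t ^ n)⁻¹ * φ (t⁻¹ • (x - y)) * g y| ≤ (∫ w, |φ w|) * B := by
  have hint : Integrable fun y => |φ (t⁻¹ • (x - y))| :=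
    (((integrable_comp_smul_iff volume φ (inv_ne_zero ht.ne')).2 hφ).comp_sub_left x).abs
  have hval : ∫ y, |φ (t⁻¹ • (x - y))| = t ^ n * ∫ w, |φ w| := by
    rw [integral_sub_left_eq_self (fun y => |φ (t⁻¹ • y)|) volume x,
      Measure.integral_comp_inv_smul_of_nonneg volume (fun w => |φ w|) ht.le]
    simp
  have htn : 0 < t ^ n := by positivity
  have hbound : ∀ y, ‖(t ^ n)⁻¹ * φ (t⁻¹ • (x - y)) * g y‖ ≤
      (t ^ n)⁻¹ * B * |φ (t⁻¹ • (x - y))| := by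
    intro y
    rw [Real.norm_eq_abs, abs_mul, abs_mul, abs_of_pos (inv_pos.2 htn), mul_assoc, mul_assoc]
    refine mul_le_mul_of_nonneg_left ?_ (inv_pos.2 htn).le
    by_cases h : φ (t⁻¹ • (x - y)) = 0
    · simp [h]
    · rw [mul_comm B]
      refine mul_le_mul_of_nonneg_left (hg y ?_) (abs_nonneg _)
      have := hφs (subset_tsupport φ h)
      rwa [mem_ball_zero_iff, norm_smul, norm_inv, Real.norm_of_nonneg ht.le,
        inv_mul_lt_iff₀ ht, mul_one] at this
  have := norm_integral_le_of_norm_le (hint.const_mul ((t ^ n)⁻¹ * B))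
    (Eventually.of_forall hbound)
  rw [integral_const_mul, hval, Real.norm_eq_abs] at this
  refine this.trans (le_of_eq ?_)
  field_simp

/-- The Taylor polynomial of degree less than `m` at `z` of the function
`y ↦ t⁻ⁿ φ((x - y) / t)`. -/
def mollifierTaylor (φ : Rn n → ℝ) (m : ℕ) (x z : Rn n) (t : ℝ) (y : Rn n) : ℝ :=
  (t ^ n)⁻¹ * ∑ k ∈ Finset.range m,
    dirDeriv k (t⁻¹ • (z - y)) φ (t⁻¹ • (x - z)) / k.factorial

theorem mollifierTaylor_mem_polyLT (φ : Rn n → ℝ) (m : ℕ) (x z : Rn n) (t : ℝ) :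
    mollifierTaylor φ m x z t ∈ polyLT n m := by
  have h : mollifierTaylor φ m x z t = (t ^ n)⁻¹ • ∑ k ∈ Finset.range m,
      ((k.factorial : ℝ)⁻¹ • fun y => dirDeriv k (t⁻¹ • (z - y)) φ (t⁻¹ • (x - z))) := by
    funext y
    simp [mollifierTaylor, Finset.sum_apply, div_eq_inv_mul]
  rw [h]
  refine Submodule.smul_mem _ _ (Submodule.sum_mem _ fun k hk => Submodule.smul_mem _ _ ?_)
  refine polyLT_mono (Nat.succ_le_of_lt (Finset.mem_range.1 hk)) ?_
  refine dirDeriv_affine_mem_polyLT (-t⁻¹) (fun i => t⁻¹ * z i) _ (fun y i => ?_) _ _ _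
  simp
  ring

theorem mollifierTaylor_eq_zero {φ : Rn n → ℝ} {m : ℕ} {x z : Rn n} {t : ℝ}
    (h : ∀ l, listDeriv l φ (t⁻¹ • (x - z)) = 0) (y : Rn n) :
    mollifierTaylor φ m x z t y = 0 := by
  simp [mollifierTaylor, dirDeriv_eq_zero _ _ _ φ h]

theorem abs_mollifier_sub_taylor_le {φ : Rn n → ℝ} (hφ : ContDiff ℝ (⊤ : ℕ∞) φ) {m : ℕ} {M : ℝ}
    (hM : 0 ≤ M) (hφM : ∀ v w, |dirDeriv m v φ w| ≤ M * (∑ i, |v i|) ^ m) {c x z : Rn n}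
    {t R : ℝ} (ht : 0 < t) (hz : ‖z - c‖ ≤ R) (y : Rn n) :
    |(t ^ n)⁻¹ * φ (t⁻¹ • (x - y)) - mollifierTaylor φ m x z t y| ≤
      (t ^ n)⁻¹ * (M * (n * t⁻¹) ^ m) * (‖y - c‖ + R) ^ m := by
  have htn : 0 < t ^ n := by positivity
  have htaylor := abs_taylor_dirDeriv_le (m := m) (U := Set.univ) (c := 0) isOpen_univ
    (hφ.of_le (by exact_mod_cast le_top)).contDiffOn (t⁻¹ • (x - z)) (t⁻¹ • (z - y))
    (fun _ _ => Set.mem_univ _) (B := M * (∑ i, |(t⁻¹ • (z - y)) i|) ^ m)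
    (fun s _ => by rw [sub_zero]; exact hφM _ _)
  rw [← smul_add, sub_add_sub_cancel, zero_div, add_zero] at htaylor
  rw [mollifierTaylor, ← mul_sub, abs_mul, abs_of_pos (inv_pos.2 htn), mul_assoc]
  refine mul_le_mul_of_nonneg_left (htaylor.trans ?_) (inv_pos.2 htn).le
  rw [mul_assoc, ← mul_pow]
  refine mul_le_mul_of_nonneg_left (pow_le_pow_left₀ (by positivity) ?_ m) hM
  have hzy : ‖z - y‖ ≤ ‖y - c‖ + R := by
    have := norm_sub_le_norm_sub_add_norm_sub z c y
    rw [norm_sub_rev c y] at this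
    linarith
  calc ∑ i, |(t⁻¹ • (z - y)) i| ≤ ∑ _i : Fin n, t⁻¹ * ‖z - y‖ := by
        refine Finset.sum_le_sum fun i _ => ?_
        have := PiLp.norm_apply_le (t⁻¹ • (z - y)) i
        rwa [norm_smul, norm_inv, Real.norm_of_nonneg ht.le, Real.norm_eq_abs] at this
    _ = n * t⁻¹ * ‖z - y‖ := by simp [mul_assoc]
    _ ≤ n * t⁻¹ * (‖y - c‖ + R) := by gcongr

theorem aestronglyMeasurable_or_exists_listDeriv_eq_zero {φ h : Rn n → ℝ}
    (hφ : ContDiff ℝ (⊤ : ℕ∞) φ) {c x : Rn n} {t R : ℝ} (ht : 0 < t)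
    (hcont : ∀ y, R ≤ ‖y - c‖ → ContinuousAt h y)
    (hint : AEStronglyMeasurable fun y => φ (t⁻¹ • (x - y)) * h y) :
    AEStronglyMeasurable h ∨ ∃ z, ‖z - c‖ ≤ R ∧ ∀ l, listDeriv l φ (t⁻¹ • (x - z)) = 0 := by
  by_contra! hcon
  obtain ⟨hnot, hz⟩ := hcon
  refine hnot ?_
  have hS : MeasurableSet {y : Rn n | R ≤ ‖y - c‖} :=
    (isClosed_le continuous_const (by fun_prop)).measurableSet
  have hout : AEStronglyMeasurable h (volume.restrict {y | R ≤ ‖y - c‖}) :=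
    ContinuousOn.aestronglyMeasurable (fun y hy => (hcont y hy).continuousWithinAt) hS
  have hqmp : Measure.QuasiMeasurePreserving (fun y : Rn n => t⁻¹ • (x - y)) volume volume := by
    refine Measure.QuasiMeasurePreserving.comp (g := fun y : Rn n => t⁻¹ • y)
      (f := fun y => x - y) ?_ ?_ (μb := volume)
    · exact ⟨by fun_prop, by
        rw [Measure.map_addHaar_smul volume (inv_ne_zero ht.ne')]
        exact Measure.smul_absolutelyContinuous⟩
    · exact (Measure.measurePreserving_sub_left volume x).quasiMeasurePreserving
  have hae := hqmp.ae (ae_forall_listDeriv_eq_zero hφ)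
  have hin : AEStronglyMeasurable h (volume.restrict {y | R ≤ ‖y - c‖}ᶜ) := by
    have hm : AEStronglyMeasurable
        (fun y => (φ (t⁻¹ • (x - y)))⁻¹ * (φ (t⁻¹ • (x - y)) * h y)) volume := by
      refine AEStronglyMeasurable.mul ?_ hint
      have hφc := hφ.continuous
      have : Continuous fun y => φ (t⁻¹ • (x - y)) := by fun_prop
      exact this.measurable.inv.aestronglyMeasurable
    refine hm.restrict.congr ?_
    refine (ae_restrict_iff' hS.compl).2 ?_
    filter_upwards [hae] with y hy hyS
    obtain ⟨l, hl⟩ := hz y (le_of_not_ge hyS)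
    rw [inv_mul_cancel_left₀]
    exact fun h0 => hl (hy h0 l)
  have := aestronglyMeasurable_union_iff.2 ⟨hout, hin⟩
  rwa [Set.union_compl_self, Measure.restrict_univ] at this

theorem abs_integral_mollifier_le_of_moments {φ h : Rn n → ℝ} (hφ : ContDiff ℝ (⊤ : ℕ∞) φ) {m : ℕ}
    {M : ℝ} (hM : 0 ≤ M) (hφM : ∀ v w, |dirDeriv m v φ w| ≤ M * (∑ i, |v i|) ^ m) {c x : Rn n}
    {t R E : ℝ} (ht : 0 < t) (hR : 0 ≤ R) (hE : 0 ≤ E)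
    (hcont : ∀ y, R ≤ ‖y - c‖ → ContinuousAt h y)
    (hmom : AEStronglyMeasurable h → ∀ β : Fin n → ℕ, ∑ i, β i < m →
      Integrable (fun y => (∏ i, y i ^ β i) * h y) ∧ ∫ y, (∏ i, y i ^ β i) * h y = 0)
    (hbd : ∀ (B : ℝ) (G : Rn n → ℝ), 0 ≤ B → (∀ y, |G y| ≤ B * (‖y - c‖ + R) ^ m) →
      ∫⁻ y, ENNReal.ofReal |G y * h y| ≤ ENNReal.ofReal (E * B)) :
    |∫ y, (t ^ n)⁻¹ * φ (t⁻¹ • (x - y)) * h y| ≤ E * ((t ^ n)⁻¹ * (M * (n * t⁻¹) ^ m)) := by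
  have hB : 0 ≤ (t ^ n)⁻¹ * (M * (n * t⁻¹) ^ m) := by positivity
  by_cases hint : Integrable fun y => (t ^ n)⁻¹ * φ (t⁻¹ • (x - y)) * h y
  swap
  · rw [integral_undef hint, abs_zero]
    positivity
  obtain ⟨z, hz, hPint, hPzero⟩ : ∃ z, ‖z - c‖ ≤ R ∧
      Integrable (fun y => mollifierTaylor φ m x z t y * h y) ∧
      ∫ y, mollifierTaylor φ m x z t y * h y = 0 := by
    have hint' : AEStronglyMeasurable fun y => φ (t⁻¹ • (x - y)) * h y := by
      refine (hint.const_mul (t ^ n)).aestronglyMeasurable.congr (Eventually.of_forall fun y => ?_)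
      have : t ^ n ≠ 0 := by positivity
      simp only [mul_assoc]
      rw [mul_inv_cancel_left₀ this]
    rcases aestronglyMeasurable_or_exists_listDeriv_eq_zero hφ ht hcont hint' with hh | ⟨z, hz, h0⟩
    · exact ⟨c, by simpa using hR, integrable_and_integral_polyLT_mul_eq_zero (hmom hh)
        (mollifierTaylor_mem_polyLT φ m x c t)⟩
    · exact ⟨z, hz, by simp [mollifierTaylor_eq_zero h0], by simp [mollifierTaylor_eq_zero h0]⟩
  have heq : ∫ y, (t ^ n)⁻¹ * φ (t⁻¹ • (x - y)) * h y =
      ∫ y, ((t ^ n)⁻¹ * φ (t⁻¹ • (x - y)) - mollifierTaylor φ m x z t y) * h y := by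
    simp only [sub_mul]
    rw [integral_sub hint hPint, hPzero, sub_zero]
  have hle := hbd _ _ hB (abs_mollifier_sub_taylor_le hφ hM hφM (x := x) ht hz)
  rw [heq, ← Real.norm_eq_abs]
  refine (norm_integral_le_lintegral_norm _).trans ?_
  exact ENNReal.toReal_le_of_le_ofReal (by positivity) hle

theorem exists_abs_monomial_le {m : ℕ} (β : Fin n → ℕ) (hβ : ∑ i, β i ≤ m) (c : Rn n) {R : ℝ}
    (hR : 0 < R) :
    ∃ B : ℝ, 0 ≤ B ∧ ∀ y : Rn n, |∏ i, y i ^ β i| ≤ B * (‖y - c‖ + R) ^ m := by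
  refine ⟨(1 + ‖c‖ / R) ^ (∑ i, β i) * (R ^ (m - ∑ i, β i))⁻¹, by positivity, fun y => ?_⟩
  set s := ‖y - c‖ + R with hs
  have hRs : R ≤ s := by rw [hs]; linarith [norm_nonneg (y - c)]
  have hs0 : 0 < s := hR.trans_le hRs
  have hy : ∀ i, |y i| ≤ (1 + ‖c‖ / R) * s := by
    intro i
    have h1 : |y i| ≤ ‖y‖ := PiLp.norm_apply_le y i
    have h2 : ‖y‖ ≤ ‖y - c‖ + ‖c‖ := by simpa using norm_add_le (y - c) c
    have h3 : ‖c‖ ≤ ‖c‖ / R * s := by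
      rw [div_mul_eq_mul_div, le_div_iff₀ hR]
      gcongr
    linarith
  have hsplit : s ^ m = s ^ (m - ∑ i, β i) * s ^ (∑ i, β i) := by
    rw [← pow_add, Nat.sub_add_cancel hβ]
  calc |∏ i, y i ^ β i| = ∏ i, |y i| ^ β i := by simp [Finset.abs_prod, abs_pow]
    _ ≤ ∏ i, ((1 + ‖c‖ / R) * s) ^ β i :=
        Finset.prod_le_prod (fun i _ => by positivity)
          fun i _ => pow_le_pow_left₀ (abs_nonneg _) (hy i) _
    _ = (1 + ‖c‖ / R) ^ (∑ i, β i) * s ^ (∑ i, β i) := by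
        rw [Finset.prod_pow_eq_pow_sum, mul_pow]
    _ ≤ (1 + ‖c‖ / R) ^ (∑ i, β i) * ((R ^ (m - ∑ i, β i))⁻¹ * s ^ m) := by
        refine mul_le_mul_of_nonneg_left ?_ (by positivity)
        rw [hsplit, ← mul_assoc]
        refine le_mul_of_one_le_left (by positivity) ?_
        rw [← div_eq_inv_mul, one_le_div (by positivity)]
        exact pow_le_pow_left₀ hR.le hRs _
    _ = _ := by rw [mul_assoc]

theorem lt_norm_sub_of_notMem_stdCube {c x : Rn n} {r : ℝ} (h : x ∉ stdCube c r) :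
    r < ‖x - c‖ := by
  by_contra! hle
  exact h fun i => (PiLp.norm_apply_le (x - c) i).trans hle

/-- (Pointwise decay for non-convolution Calderón–Zygmund operators.)
Let `L ≥ -1` and let `T` be a Calderón–Zygmund operator whose kernel satisfies the
higher-order smoothness condition for `|β| = L+1`, and which has `L` vanishing moments.
Then for every `(L+1,∞)` atom `a` supported in `Q` and every `x ∈ (Q^{**})^c`,
`M_φ(Ta)(x) ≤ C' M(χ_Q)(x)^{(n+L+1)/n}`. -/
theorem stmt18_maximal_decay_nonconvolution (n : ℕ) (L : ℤ) (hL : -1 ≤ L)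
    (T : (Rn n → ℝ) → Rn n → ℝ) (K : Rn n → Rn n → ℝ) (δ : ℝ)
    (hT : CZOp T K δ)
    (hsm : ∃ C : ℝ, 0 < C ∧ KernelHigherSmooth K δ (L + 1).toNat C)
    (hvm : VanishingMoments T L)
    (φ : Rn n → ℝ) (hφs : ContDiff ℝ (⊤ : ℕ∞) φ)
    (hφc : tsupport φ ⊆ Metric.ball 0 1) (hφi : ∫ x, φ x = 1) :
    ∃ C' : ℝ, 0 < C' ∧
      ∀ (a : Rn n → ℝ) (c : Rn n) (r : ℝ), 0 < r →
        IsNAtom (L + 1).toNat a (stdCube c r) →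
        ∀ x : Rn n, x ∉ stdCube c (4 * n * r) →
          MphiSup φ (T a) x ≤ ENNReal.ofReal C' *
            fracMax 0 ((stdCube c r).indicator fun _ => (1 : ℝ)) x ^
              (((n : ℝ) + L + 1) / n) := by
  rcases Nat.eq_zero_or_pos n with rfl | hn
  · exact ⟨1, one_pos, fun a c r _ _ x hx => absurd (fun i => i.elim0) hx⟩
  obtain ⟨hL2, hδ, -, ⟨C₁, hC₁, hsize, hsmooth⟩, hrep⟩ := hT
  obtain ⟨C₂, hC₂, hK⟩ := hsm
  set m := (L + 1).toNat with hm
  have hmL : (m : ℤ) = L + 1 := Int.toNat_of_nonneg (by omega)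
  have hmL' : (n : ℝ) + L + 1 = (n + m : ℕ) := by
    have : (m : ℝ) = L + 1 := by exact_mod_cast hmL
    push_cast
    linarith
  have hφcs : HasCompactSupport φ :=
    HasCompactSupport.of_support_subset_isCompact (isCompact_closedBall (0 : Rn n) 1)
      ((subset_tsupport φ).trans (hφc.trans Metric.ball_subset_closedBall))
  have hφint : Integrable φ := hφs.continuous.integrable_of_hasCompactSupport hφcs
  obtain ⟨M, hM, hφM⟩ := exists_abs_dirDeriv_le m φ hφs hφcs
  obtain ⟨D, hD, hdecay⟩ := KernelHigherSmooth.exists_abs_integral_le hn hδ hC₂ hK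
  obtain ⟨W, hW, hTL2⟩ := hL2.exists_lintegral_sq_le
  obtain ⟨E, hE, hpair⟩ := exists_lintegral_mul_le hn m hδ hD hW
  set A₁ : ℝ := (∫ w, |φ w|) * (D * 2 ^ ((n : ℝ) + m + δ)) with hA₁
  set A₂ : ℝ := E * (M * n ^ m * 2 ^ (n + m)) with hA₂
  have hφ0 : 0 ≤ ∫ w, |φ w| := integral_nonneg fun w => abs_nonneg _
  have hA₁0 : 0 ≤ A₁ := by positivity
  have hA₂0 : 0 ≤ A₂ := by positivity
  refine ⟨A₁ + A₂ + 1, by positivity, ?_⟩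
  intro a c r hr ha x hx
  have hn1 : (1 : ℝ) ≤ n := by exact_mod_cast hn
  have hnr : r ≤ n * r := le_mul_of_one_le_left hr.le hn1
  set d := ‖x - c‖ with hd
  have hdr : 4 * (n * r) < d := by
    have := lt_norm_sub_of_notMem_stdCube hx
    linarith
  have hd0 : 0 < d := by linarith
  have hTa : ∀ y, n * r < ‖y - c‖ → T a y = ∫ z, K y z * a z := fun y hy =>
    hrep a ha.1 ⟨1, ha.2.1⟩
      (HasCompactSupport.of_support_subset_isCompact (isCompact_stdCube c r) ha.2.2.2.1) y
      fun h => notMem_stdCube_of_lt_norm hy (ha.tsupport_subset h)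
  have hTadecay : ∀ y, 2 * (n * r) ≤ ‖y - c‖ →
      |T a y| ≤ D * (r / ‖y - c‖) ^ ((n : ℝ) + m + δ) := by
    intro y hy
    rw [hTa y (by linarith)]
    exact hdecay a c r hr ha y hy
  have hTacont : ∀ y, 2 * (n * r) ≤ ‖y - c‖ → ContinuousAt (T a) y := by
    intro y hy
    have hy' : n * r < ‖y - c‖ := by linarith
    refine (continuousAt_integral_kernel hδ hC₁ hsize hsmooth hK ha hy').congr ?_
    have : ∀ᶠ w in 𝓝 y, n * r < ‖w - c‖ :=
      ContinuousAt.eventually_lt continuousAt_const (by fun_prop) hy'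
    filter_upwards [this] with w hw
    exact (hTa w hw).symm
  have hbd : ∀ (B : ℝ) (G : Rn n → ℝ), 0 ≤ B → (∀ y, |G y| ≤ B * (‖y - c‖ + 2 * (n * r)) ^ m) →
      ∫⁻ y, ENNReal.ofReal |G y * T a y| ≤ ENNReal.ofReal (E * r ^ (n + m) * B) := by
    intro B G hB hG
    rw [mul_right_comm]
    exact hpair (T a) c r hr hTadecay (hTL2 m a c r hr ha) B G hB hG
  have hmom : AEStronglyMeasurable (T a) → ∀ β : Fin n → ℕ, ∑ i, β i < m →
      Integrable (fun y => (∏ i, y i ^ β i) * T a y) ∧ ∫ y, (∏ i, y i ^ β i) * T a y = 0 := by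
    intro hmeas β hβ
    refine ⟨⟨(Continuous.aestronglyMeasurable (by fun_prop)).mul hmeas, ?_⟩,
      hvm a _ ha β ?_⟩
    · obtain ⟨B, hB, hle⟩ := exists_abs_monomial_le β hβ.le c
        (show 0 < 2 * (n * r) by linarith)
      rw [hasFiniteIntegral_iff_norm]
      exact (hbd B _ hB hle).trans_lt ENNReal.ofReal_lt_top
    · have : ((∑ i, β i : ℕ) : ℤ) < m := by exact_mod_cast hβ
      push_cast at this
      omega
  have hrd : 0 < r / d := by positivity
  have hrd1 : r / d ≤ 1 := (div_le_one hd0).2 (by linarith)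
  have hnear : ∀ t, 0 < t → t ≤ d / 2 →
      |∫ y, (t ^ n)⁻¹ * φ (t⁻¹ • (x - y)) * T a y| ≤ A₁ * (r / d) ^ (n + m) := by
    intro t ht htd
    refine (abs_integral_mollifier_le hφint hφc (B := D * 2 ^ ((n : ℝ) + m + δ) *
      (r / d) ^ (n + m)) ht fun y hy => ?_).trans (le_of_eq (by rw [hA₁]; ring))
    have hyd : d / 2 ≤ ‖y - c‖ := by
      have : d ≤ ‖x - y‖ + ‖y - c‖ := norm_sub_le_norm_sub_add_norm_sub x y c
      linarith
    refine (hTadecay y (by linarith)).trans ?_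
    rw [mul_assoc]
    refine mul_le_mul_of_nonneg_left ?_ hD
    calc (r / ‖y - c‖) ^ ((n : ℝ) + m + δ) ≤ (2 * (r / d)) ^ ((n : ℝ) + m + δ) := by
          refine Real.rpow_le_rpow (by positivity) ?_ (by positivity)
          calc r / ‖y - c‖ ≤ r / (d / 2) := by gcongr
            _ = 2 * (r / d) := by field_simp
      _ = 2 ^ ((n : ℝ) + m + δ) * (r / d) ^ ((n : ℝ) + m + δ) :=
          Real.mul_rpow (by norm_num) hrd.le
      _ ≤ 2 ^ ((n : ℝ) + m + δ) * (r / d) ^ (n + m) := by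
          refine mul_le_mul_of_nonneg_left ?_ (by positivity)
          rw [← Real.rpow_natCast]
          refine Real.rpow_le_rpow_of_exponent_ge hrd hrd1 ?_
          push_cast
          linarith
  have hfar : ∀ t, 0 < t → d / 2 ≤ t →
      |∫ y, (t ^ n)⁻¹ * φ (t⁻¹ • (x - y)) * T a y| ≤ A₂ * (r / d) ^ (n + m) := by
    intro t ht htd
    refine (abs_integral_mollifier_le_of_moments hφs hM hφM ht (by positivity) (by positivity)
      hTacont hmom hbd).trans ?_
    have hle : (r / t) ^ (n + m) ≤ (2 * (r / d)) ^ (n + m) := by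
      refine pow_le_pow_left₀ (by positivity) ?_ _
      calc r / t ≤ r / (d / 2) := by gcongr
        _ = 2 * (r / d) := by field_simp
    calc E * r ^ (n + m) * ((t ^ n)⁻¹ * (M * (n * t⁻¹) ^ m))
        = E * (M * n ^ m) * (r / t) ^ (n + m) := by
          rw [div_pow, pow_add t, mul_pow, inv_pow]
          field_simp
      _ ≤ E * (M * n ^ m) * (2 * (r / d)) ^ (n + m) := by gcongr
      _ = A₂ * (r / d) ^ (n + m) := by rw [hA₂, mul_pow]; ring
  have hmax : ENNReal.ofReal ((r / d) ^ (n + m)) ≤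
      fracMax 0 ((stdCube c r).indicator fun _ => (1 : ℝ)) x ^ (((n : ℝ) + L + 1) / n) := by
    have h := ENNReal.rpow_le_rpow
      (ofReal_le_fracMax_indicator hr (by linarith : r ≤ d) le_rfl)
      (show 0 ≤ ((n : ℝ) + L + 1) / n by rw [hmL']; positivity)
    refine le_trans (le_of_eq ?_) h
    rw [hmL', ENNReal.ofReal_rpow_of_nonneg (by positivity) (by positivity),
      ← Real.rpow_natCast (r / d) n, ← Real.rpow_mul hrd.le, mul_div_cancel₀ _ (by positivity),
      Real.rpow_natCast]
  refine le_trans ?_ (mul_le_mul_right hmax _)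
  rw [← ENNReal.ofReal_mul (by positivity)]
  refine iSup₂_le fun t ht => ENNReal.ofReal_le_ofReal ?_
  have hpow : 0 ≤ (r / d) ^ (n + m) := by positivity
  rcases le_total t (d / 2) with htd | htd
  · refine (hnear t ht htd).trans (mul_le_mul_of_nonneg_right ?_ hpow)
    linarith
  · refine (hfar t ht htd).trans (mul_le_mul_of_nonneg_right ?_ hpow)
    linarith
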